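/- arXiv:2007.13309 — 2 statements merged into one kernel-verified Lean document; each statement's English description precedes it below -/
import Mathlib

section
/- Let q be a prime power, m ≥ 2 an even integer, r = q+1, and δ₀ = δ^max + 1. Define i₀ = (q^{m+1}−3q^{m−1}−2)/(q+1) if m > 2, or if m = 2 and q ≤ 4, and i₀ = (q³−q²−4q−2)/(q+1) if m = 2 and q ≥ 5 (both quotients are integers). Then 0 ≤ i₀ ≤ δ₀−2 and 1+r·i₀ ∈ T_{δ₀} ∩ T_{δ₀}^{−q}; in particular T_{δ₀} ∩ T_{δ₀}^{−q} ≠ ∅. -/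
/-- The q²-cyclotomic coset of `s` modulo `M`, viewed inside `ZMod M`. -/
def coset (q M s : ℕ) : Set (ZMod M) :=
  {x | ∃ l : ℕ, x = (s : ZMod M) * (q : ZMod M) ^ (2 * l)}

/-- The maximum design distance `δ^max`. -/
def deltaMax (q m : ℕ) : ℕ :=
  if m = 2 ∧ 5 ≤ q then (q ^ 3 - q ^ 2 + q + 3) / (q + 1) + 1
  else (q ^ (m + 1) - q ^ 2 + q + 3) / (q + 1)

/-- The defining set `T_δ = ∪_{i=0}^{δ−2} C_{1+r·i}` inside `ZMod (q^{2m}−1)`. -/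
def Tset (q m r δ : ℕ) : Set (ZMod (q ^ (2 * m) - 1)) :=
  ⋃ i ∈ Finset.range (δ - 1), coset q (q ^ (2 * m) - 1) (1 + r * i)

/-- `T_δ^{−q} = { −q·j : j ∈ T_δ }` inside `ZMod (q^{2m}−1)`. -/
def TsetNegQ (q m r δ : ℕ) : Set (ZMod (q ^ (2 * m) - 1)) :=
  (fun x => -(q : ZMod (q ^ (2 * m) - 1)) * x) '' Tset q m r δ

theorem natCast_pow_two_mul_eq_one (q m : ℕ) (hq : 1 ≤ q) :
    (q : ZMod (q ^ (2 * m) - 1)) ^ (2 * m) = 1 := by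
  have h : ((q ^ (2 * m) - 1 : ℕ) : ZMod (q ^ (2 * m) - 1)) = 0 := ZMod.natCast_self _
  rw [Nat.cast_sub (Nat.one_le_pow _ _ hq)] at h
  push_cast at h
  exact sub_eq_zero.mp h

/-- If `1 + r i` equals `-q` times an element of the coset of `1 + r j` and `i ≤ j`, then
`1 + r i` lies in both defining sets of design distance `j + 2`. -/
theorem natCast_mem_Tset_inter_TsetNegQ {q m r i j : ℕ} (l : ℕ) (hij : i ≤ j)
    (h : ((1 + r * i : ℕ) : ZMod (q ^ (2 * m) - 1)) =
      -q * ((1 + r * j : ℕ) * (q : ZMod (q ^ (2 * m) - 1)) ^ (2 * l))) :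
    ((1 + r * i : ℕ) : ZMod (q ^ (2 * m) - 1)) ∈
      Tset q m r (j + 2) ∩ TsetNegQ q m r (j + 2) := by
  refine ⟨?_, (1 + r * j : ℕ) * (q : ZMod (q ^ (2 * m) - 1)) ^ (2 * l), ?_, h.symm⟩
  · exact Set.mem_biUnion (x := i) (by simp; omega) ⟨0, by simp⟩
  · exact Set.mem_biUnion (x := j) (by simp) ⟨l, rfl⟩

theorem stmt2 (q m : ℕ) (hq : IsPrimePow q) (hm : 2 ≤ m) (hme : Even m)
    (r : ℕ) (hr : r = q + 1)
    (δ₀ : ℕ) (hδ₀ : δ₀ = deltaMax q m + 1)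
    (i₀ : ℕ)
    (hi₀ : i₀ = if m = 2 ∧ 5 ≤ q then (q ^ 3 - q ^ 2 - 4 * q - 2) / (q + 1)
                else (q ^ (m + 1) - 3 * q ^ (m - 1) - 2) / (q + 1)) :
    i₀ ≤ δ₀ - 2 ∧
    ((1 + r * i₀ : ℕ) : ZMod (q ^ (2 * m) - 1)) ∈ Tset q m r δ₀ ∩ TsetNegQ q m r δ₀ ∧
    (Tset q m r δ₀ ∩ TsetNegQ q m r δ₀).Nonempty := by
  have hq2 : 2 ≤ q := hq.two_le
  suffices H : ∃ j l, δ₀ = j + 2 ∧ i₀ ≤ j ∧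
      ((1 + r * i₀ : ℕ) : ZMod (q ^ (2 * m) - 1)) =
        -q * ((1 + r * j : ℕ) * (q : ZMod (q ^ (2 * m) - 1)) ^ (2 * l)) by
    obtain ⟨j, l, rfl, hij, h⟩ := H
    have hmem := natCast_mem_Tset_inter_TsetNegQ l hij h
    exact ⟨hij, hmem, _, hmem⟩
  have hpow := natCast_pow_two_mul_eq_one q m (by omega)
  subst hr
  by_cases hc : m = 2 ∧ 5 ≤ q
  · obtain ⟨rfl, hq5⟩ := hc
    obtain ⟨t, rfl⟩ := Nat.exists_eq_add_of_le hq5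
    -- Here `i₀ = q² - 2q - 2` and `δ^max - 1 = q² - 2q + 3`.
    have e1 : (5 + t) ^ 3 - (5 + t) ^ 2 - 4 * (5 + t) - 2
        = (5 + t + 1) * (t ^ 2 + 8 * t + 13) := by
      have : (5 + t) ^ 3
          = (5 + t + 1) * (t ^ 2 + 8 * t + 13) + 2 + 4 * (5 + t) + (5 + t) ^ 2 := by ring
      omega
    have e2 : (5 + t) ^ 3 - (5 + t) ^ 2 + (5 + t) + 3
        = (5 + t + 1) * (t ^ 2 + 8 * t + 18) := by
      have : (5 + t) ^ 3 + (5 + t) + 3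
          = (5 + t + 1) * (t ^ 2 + 8 * t + 18) + (5 + t) ^ 2 := by ring
      have : (5 + t) ^ 2 ≤ (5 + t) ^ 3 := Nat.pow_le_pow_right (by omega) (by omega)
      omega
    rw [if_pos ⟨rfl, hq5⟩, e1, Nat.mul_div_cancel_left _ (by omega)] at hi₀
    rw [deltaMax, if_pos ⟨rfl, hq5⟩, e2, Nat.mul_div_cancel_left _ (by omega)] at hδ₀
    refine ⟨t ^ 2 + 8 * t + 18, 0, hδ₀, by omega, ?_⟩
    subst hi₀
    push_cast at hpow ⊢
    linear_combination hpow
  · rw [if_neg hc] at hi₀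
    rw [deltaMax, if_neg hc] at hδ₀
    obtain ⟨k, rfl⟩ : ∃ k, m = 2 * k + 2 := by
      obtain ⟨a, rfl⟩ := hme
      exact ⟨a - 1, by omega⟩
    set P := q ^ (2 * k + 1) with hP
    have hqP : q ≤ P := Nat.le_self_pow (by omega) q
    have hpow3 : q ^ (2 * k + 2 + 1) = P * q ^ 2 := by rw [hP]; ring
    have hpow1 : q ^ (2 * k + 2 - 1) = P := rfl
    rw [hpow3, hpow1] at hi₀
    rw [hpow3] at hδ₀
    have hdvd : q + 1 ∣ P + 1 := by
      simpa using Odd.nat_add_dvd_pow_add_pow q 1 (n := 2 * k + 1) ⟨k, rfl⟩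
    have hqq : q ^ 2 ≤ P * q ^ 2 := Nat.le_mul_of_pos_left _ (by omega)
    have hPq : 3 * P + 2 ≤ P * q ^ 2 := by
      have : P * 2 ^ 2 ≤ P * q ^ 2 := by gcongr
      omega
    have hle : q ^ 2 ≤ 3 * P + 4 := by
      rcases Nat.eq_zero_or_pos k with rfl | hk
      · have : q ≤ 4 := by omega
        nlinarith
      · have : q ^ 2 ≤ P := Nat.pow_le_pow_right (by omega) (by omega)
        omega
    have hdvd_i : q + 1 ∣ P * q ^ 2 - 3 * P - 2 := by
      zify [show 3 * P ≤ P * q ^ 2 by omega, show 2 ≤ P * q ^ 2 - 3 * P by omega] at hdvd ⊢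
      obtain ⟨c, hc⟩ := hdvd
      exact ⟨P * (q - 1) - 2 * c, by linear_combination -2 * hc⟩
    have hdvd_j : q + 1 ∣ P * q ^ 2 - q ^ 2 + q + 3 := by
      zify [hqq] at hdvd ⊢
      obtain ⟨c, hc⟩ := hdvd
      exact ⟨P * (q - 1) + c - q + 2, by linear_combination hc⟩
    obtain ⟨j', hj'⟩ := hdvd_j
    obtain ⟨i, hi⟩ := hdvd_i
    rw [hj', Nat.mul_div_cancel_left _ (by omega)] at hδ₀
    rw [hi, Nat.mul_div_cancel_left _ (by omega)] at hi₀
    subst hi₀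
    obtain ⟨j, rfl⟩ : ∃ j, j' = j + 1 := by
      refine Nat.exists_eq_succ_of_ne_zero ?_
      rintro rfl
      omega
    rw [mul_add, mul_one] at hj'
    refine ⟨j, k, hδ₀, ?_, ?_⟩
    · exact Nat.le_of_mul_le_mul_left (show (q + 1) * i₀ ≤ (q + 1) * j by omega) (by omega)
    · have hs : 1 + (q + 1) * i₀ + 3 * P + 1 = P * q ^ 2 := by omega
      have hs' : 1 + (q + 1) * j + q ^ 2 = P * q ^ 2 + 3 := by omega
      generalize 1 + (q + 1) * i₀ = s at hs ⊢
      generalize 1 + (q + 1) * j = s' at hs' ⊢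
      have cs := congrArg (Nat.cast : ℕ → ZMod (q ^ (2 * (2 * k + 2)) - 1)) hs
      have cs' := congrArg (Nat.cast : ℕ → ZMod (q ^ (2 * (2 * k + 2)) - 1)) hs'
      rw [hP] at cs cs'
      push_cast at cs cs'
      linear_combination cs + (q : ZMod (q ^ (2 * (2 * k + 2)) - 1)) ^ (2 * k + 1) * cs' + hpow
end

section
/- Let q ∈ {2,3,4} be a prime power, m > 2 an even integer, and r = q+1. For every integer δ with 2 ≤ δ ≤ δ^max = (q^{m+1}−q²+q+3)/(q+1), the cardinality of ∪_{i=0}^{δ−2} C_{1+r·i} (cosets modulo q^{2m}−1) equals (δ−N₁−1)·m if 2 ≤ δ < i*+2, and equals (δ−N₁−1)·m − (m/2)·[q = 4] if i*+2 ≤ δ ≤ δ^max, where [q = 4] = 1 if q = 4 and 0 otherwise. -/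
/-- `i* = (⌈(q+1)/2⌉·(q^m+1) − [q even])/(q+1)`. -/
def istar (q m : ℕ) : ℕ :=
  ((q + 2) / 2 * (q ^ m + 1) - if Even q then 1 else 0) / (q + 1)

/-- `N₁ = ⌊(δ−(q+1))/q²⌋ + 1`, floor division in `ℤ`. -/
def N1 (q δ : ℕ) : ℤ :=
  ((δ : ℤ) - ((q : ℤ) + 1)).fdiv ((q : ℤ) ^ 2) + 1

/-- The size of the coset of `1 + (q + 1) * i`, when this number is not divisible by `q ^ 2`. -/
def period (q m i : ℕ) : ℕ :=
  if q = 4 ∧ i = istar q m then m / 2 else m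

/-- The indices below `n` whose coset leader `1 + (q + 1) * i` is not divisible by `q ^ 2`. -/
def leaders (q n : ℕ) : Finset ℕ :=
  (Finset.range n).filter fun i => ¬ q ^ 2 ∣ 1 + (q + 1) * i

lemma pow_mod_succ {q m : ℕ} (hq : q = 2 ∨ q = 3 ∨ q = 4) (hme : Even m) :
    q ^ m % (q + 1) = 1 := by
  obtain ⟨k, rfl⟩ := hme
  have h : q ^ (k + k) = (q ^ 2) ^ k := by rw [← pow_mul]; congr 1; ring
  rw [h, Nat.pow_mod]
  rcases hq with rfl | rfl | rfl <;> simp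

lemma sq_dvd_pow {q m : ℕ} (hm : 2 < m) : q ^ 2 ∣ q ^ m := pow_dvd_pow q (by omega)

lemma one_add_mul_istar {m : ℕ} (hme : Even m) : 1 + 5 * istar 4 m = 3 * (4 ^ m + 1) := by
  have h := pow_mod_succ (q := 4) (by simp) hme
  have h4 : Even 4 := by decide
  simp only [istar, if_pos h4]
  omega

lemma pow_two_mul_eq_one {q m : ℕ} (hq : 0 < q) :
    (q : ZMod (q ^ (2 * m) - 1)) ^ (2 * m) = 1 := by
  have h : 1 ≤ q ^ (2 * m) := Nat.one_le_pow _ _ hq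
  have := ZMod.natCast_self (q ^ (2 * m) - 1)
  rw [Nat.cast_sub h] at this
  push_cast at this
  exact sub_eq_zero.mp this

/-- Shifting a short word by fewer than `m` digits does not wrap around. -/
lemma sq_dvd_of_modEq {q m l s s' : ℕ} (hq : 2 ≤ q) (hm : 2 < m) (hl : 0 < l)
    (hlm : 2 * l + 2 ≤ m) (hs : s < q ^ (m + 1)) (hs' : s' < q ^ (m + 1))
    (h : s' ≡ s * q ^ (2 * l) [MOD q ^ (2 * m) - 1]) : q ^ 2 ∣ s' := by
  have hM : q ^ (2 * m - 1) < q ^ (2 * m) := Nat.pow_lt_pow_right (by omega) (by omega)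
  have h1 : q ^ (m + 1) ≤ q ^ (2 * m - 1) := Nat.pow_le_pow_right (by omega) (by omega)
  have h2 : s * q ^ (2 * l) < q ^ (2 * m - 1) := by
    calc s * q ^ (2 * l) < q ^ (m + 1) * q ^ (2 * l) :=
          Nat.mul_lt_mul_of_pos_right hs (by positivity)
      _ = q ^ (m + 1 + 2 * l) := (pow_add ..).symm
      _ ≤ q ^ (2 * m - 1) := Nat.pow_le_pow_right (by omega) (by omega)
  rw [h.eq_of_lt_of_lt (by omega) (by omega)]
  exact (pow_dvd_pow q (by omega)).mul_left s

/-- Shifting by exactly `m` digits fixes at most the word `3 0 ⋯ 0 3` in base four. -/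
lemma eq_of_modEq_mul_pow {q m s s' : ℕ} (hq : q = 2 ∨ q = 3 ∨ q = 4) (hm : 2 < m)
    (hme : Even m) (hs : s < q ^ (m + 1)) (hs' : s' < q ^ (m + 1)) (hr : s % (q + 1) = 1)
    (hd : ¬ q ^ 2 ∣ s) (hd' : ¬ q ^ 2 ∣ s')
    (h : s' ≡ s * q ^ m [MOD q ^ (2 * m) - 1]) :
    q = 4 ∧ s = 3 * (4 ^ m + 1) ∧ s' = 3 * (4 ^ m + 1) := by
  have hq0 : 2 ≤ q := by omega
  set P := q ^ m with hP
  have hPP : q ^ (2 * m) = P * P := by rw [hP, ← pow_add]; congr 1; ring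
  have hPq : q ^ (m + 1) = P * q := pow_succ ..
  have hqP : q * q ≤ P := by
    rw [hP, ← sq]; exact Nat.pow_le_pow_right (by omega) (by omega)
  have hdP : q ^ 2 ∣ P := sq_dvd_pow hm
  have hPmod : P % (q + 1) = 1 := pow_mod_succ hq hme
  rw [hPP] at h
  rw [hPq] at hs hs'
  have hPpos : 0 < P := by nlinarith
  obtain ⟨a, b, hb, hab⟩ : ∃ a b, b < P ∧ s = a * P + b :=
    ⟨s / P, s % P, Nat.mod_lt _ hPpos, by rw [mul_comm]; exact (Nat.div_add_mod s P).symm⟩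
  have ha : a < q := by
    by_contra hc
    nlinarith
  have hmod : s * P ≡ b * P + a [MOD P * P - 1] := by
    have hone : P * P ≡ 1 [MOD P * P - 1] := by
      have := (Nat.modEq_iff_dvd' (n := P * P - 1) (a := 1) (b := P * P) (by nlinarith)).2 dvd_rfl
      exact this.symm
    calc s * P = a * (P * P) + b * P := by rw [hab]; ring
      _ ≡ a * 1 + b * P [MOD P * P - 1] := (hone.mul_left a).add_right _
      _ = b * P + a := by ring
  have hs'eq : s' = b * P + a := by
    refine (h.trans hmod).eq_of_lt_of_lt ?_ ?_
    · have : P * q + 1 < P * P := by nlinarith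
      omega
    · have h1 : (b + 1) * P ≤ P * P := Nat.mul_le_mul_right P hb
      have h2 : a + 1 < P := by nlinarith
      have h3 : (b + 1) * P = b * P + P := by ring
      omega
  have hbq : b < q := by
    by_contra hc
    nlinarith
  have hb0 : b ≠ 0 := by
    rintro rfl
    exact hd (by rw [hab]; simpa using hdP.mul_left a)
  have ha0 : a ≠ 0 := by
    rintro rfl
    exact hd' (by rw [hs'eq]; simpa using hdP.mul_left b)
  have hsum : (a + b) % (q + 1) = 1 := by
    have : s ≡ a * 1 + b [MOD q + 1] := by
      rw [hab]
      refine (Nat.ModEq.mul_left a ?_).add_right b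
      rw [Nat.ModEq, hPmod, Nat.mod_eq_of_lt (by omega)]
    rw [Nat.ModEq, hr] at this
    simpa using this.symm
  rcases hq with rfl | rfl | rfl
  · omega
  · omega
  · obtain ⟨rfl, rfl⟩ : a = 3 ∧ b = 3 := by omega
    exact ⟨rfl, by omega, by omega⟩

lemma eq_of_shift {q m l s s' : ℕ} (hq : q = 2 ∨ q = 3 ∨ q = 4) (hm : 2 < m)
    (hme : Even m) (hs : s < q ^ (m + 1)) (hs' : s' < q ^ (m + 1)) (hr : s % (q + 1) = 1)
    (hd : ¬ q ^ 2 ∣ s) (hd' : ¬ q ^ 2 ∣ s') (hl : 0 < l) (hlm : l < m)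
    (h : (s' : ZMod (q ^ (2 * m) - 1)) = s * (q : ZMod (q ^ (2 * m) - 1)) ^ (2 * l)) :
    q = 4 ∧ s = 3 * (4 ^ m + 1) ∧ s' = 3 * (4 ^ m + 1) ∧ 2 * l = m := by
  have hcast {a b k : ℕ} (h : (a : ZMod (q ^ (2 * m) - 1)) = b *
      (q : ZMod (q ^ (2 * m) - 1)) ^ (2 * k)) :
      a ≡ b * q ^ (2 * k) [MOD q ^ (2 * m) - 1] := by
    rw [← ZMod.natCast_eq_natCast_iff]
    push_cast
    exact h
  obtain ⟨k, hk⟩ := hme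
  rcases lt_trichotomy l k with hlk | rfl | hlk
  · exact absurd (sq_dvd_of_modEq (by omega) hm hl (by omega) hs hs' (hcast h)) hd'
  · have h2 := hcast h
    rw [show 2 * l = m by omega] at h2
    obtain ⟨h3, h4, h5⟩ := eq_of_modEq_mul_pow hq hm ⟨l, hk⟩ hs hs' hr hd hd' h2
    exact ⟨h3, h4, h5, by omega⟩
  · refine absurd (sq_dvd_of_modEq (l := m - l) (by omega) hm (by omega) (by omega) hs' hs
      (hcast ?_)) hd
    rw [h, mul_assoc, ← pow_add, show 2 * l + 2 * (m - l) = 2 * m by omega,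
      pow_two_mul_eq_one (by omega), mul_one]

lemma period_pos {q m i : ℕ} (hm : 2 < m) : 0 < period q m i := by
  unfold period
  split_ifs <;> omega

lemma period_le (q m i : ℕ) : period q m i ≤ m := by
  unfold period
  split_ifs <;> omega

lemma mul_pow_period {q m : ℕ} (hq : 0 < q) (hme : Even m) (i : ℕ) :
    ((1 + (q + 1) * i : ℕ) : ZMod (q ^ (2 * m) - 1)) *
      (q : ZMod (q ^ (2 * m) - 1)) ^ (2 * period q m i) = (1 + (q + 1) * i : ℕ) := by
  unfold period
  split_ifs with h
  · obtain ⟨rfl, rfl⟩ := h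
    have h1 : 2 * (m / 2) = m := Nat.two_mul_div_two_of_even hme
    have h2 := pow_two_mul_eq_one (m := m) hq
    have h3 : ((4 : ℕ) : ZMod (4 ^ (2 * m) - 1)) ^ (2 * m) =
        (4 : ZMod (4 ^ (2 * m) - 1)) ^ m * 4 ^ m := by
      push_cast
      rw [two_mul, pow_add (4 : ZMod _)]
    rw [h3] at h2
    rw [one_add_mul_istar hme, h1]
    push_cast
    linear_combination 3 * h2
  · rw [pow_two_mul_eq_one hq, mul_one]

lemma mul_pow_mod_period {q m : ℕ} (hq : 0 < q) (hme : Even m) (i l : ℕ) :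
    ((1 + (q + 1) * i : ℕ) : ZMod (q ^ (2 * m) - 1)) *
      (q : ZMod (q ^ (2 * m) - 1)) ^ (2 * (l % period q m i)) =
    (1 + (q + 1) * i : ℕ) * (q : ZMod (q ^ (2 * m) - 1)) ^ (2 * l) := by
  have key (k : ℕ) : ((1 + (q + 1) * i : ℕ) : ZMod (q ^ (2 * m) - 1)) *
      ((q : ZMod (q ^ (2 * m) - 1)) ^ (2 * period q m i)) ^ k = (1 + (q + 1) * i : ℕ) := by
    induction k with
    | zero => simp
    | succ k ih => rw [pow_succ, ← mul_assoc, ih, mul_pow_period hq hme]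
  conv_rhs => rw [← Nat.div_add_mod l (period q m i)]
  rw [mul_add, pow_add, ← mul_assoc, ← mul_assoc 2, pow_mul _ (2 * _), key]

lemma sq_dvd_iff {q : ℕ} (hq : q = 2 ∨ q = 3 ∨ q = 4) (i : ℕ) :
    q ^ 2 ∣ 1 + (q + 1) * i ↔ i % q ^ 2 = q - 1 := by
  rcases hq with rfl | rfl | rfl <;> norm_num <;> omega

lemma exists_leader {q M : ℕ} (hq : q = 2 ∨ q = 3 ∨ q = 4) {n i : ℕ} (hi : i < n) {x : ZMod M}
    (hx : x ∈ coset q M (1 + (q + 1) * i)) :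
    ∃ j ∈ leaders q n, x ∈ coset q M (1 + (q + 1) * j) := by
  induction i using Nat.strong_induction_on with
  | _ i ih =>
    by_cases hd : q ^ 2 ∣ 1 + (q + 1) * i
    · have hj : 1 + (q + 1) * i = (1 + (q + 1) * (i / q ^ 2)) * q ^ 2 := by
        have h := (sq_dvd_iff hq i).1 hd
        rcases hq with rfl | rfl | rfl <;> norm_num at h ⊢ <;> omega
      have hlt : i / q ^ 2 < i := by
        have h := (sq_dvd_iff hq i).1 hd
        rcases hq with rfl | rfl | rfl <;> norm_num at h ⊢ <;> omega
      refine ih _ hlt (hlt.trans hi) ?_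
      obtain ⟨l, rfl⟩ := hx
      refine ⟨l + 1, ?_⟩
      rw [hj]
      push_cast
      ring
    · exact ⟨i, by simp [leaders, hi, hd], hx⟩

lemma leaders_card {q : ℕ} (hq : q = 2 ∨ q = 3 ∨ q = 4) (n : ℕ) :
    (leaders q n).card = n - (n + q ^ 2 - q) / q ^ 2 := by
  induction n with
  | zero => rcases hq with rfl | rfl | rfl <;> simp [leaders]
  | succ n ih =>
    have hle : leaders q (n + 1) =
        if ¬ q ^ 2 ∣ 1 + (q + 1) * n then insert n (leaders q n) else leaders q n := by
      rw [leaders, Finset.range_add_one, Finset.filter_insert, leaders]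
    simp only [hle, sq_dvd_iff hq]
    have hn : n ∉ leaders q n := by simp [leaders]
    split_ifs with h
    · rw [ih]
      rcases hq with rfl | rfl | rfl <;> norm_num at h ⊢ <;> omega
    · rw [Finset.card_insert_of_notMem hn, ih]
      rcases hq with rfl | rfl | rfl <;> norm_num at h ⊢ <;> omega

lemma sum_period {q m : ℕ} (hm : 2 < m) (hme : Even m) (n : ℕ) :
    ∑ i ∈ leaders q n, period q m i + (if q = 4 ∧ istar q m < n then m / 2 else 0) =
      (leaders q n).card * m := by
  have hmem : q = 4 ∧ istar q m < n ↔ q = 4 ∧ istar q m ∈ leaders q n := by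
    refine and_congr_right ?_
    rintro rfl
    have h := one_add_mul_istar hme
    have h16 : (4 : ℕ) ^ 2 ∣ 4 ^ m := sq_dvd_pow hm
    have : ¬ (4 : ℕ) ^ 2 ∣ 1 + (4 + 1) * istar 4 m := by
      norm_num at h16 ⊢
      omega
    rw [leaders, Finset.mem_filter, Finset.mem_range, and_iff_left this]
  have hsum : (if q = 4 ∧ istar q m < n then m / 2 else 0) =
      ∑ i ∈ leaders q n, if q = 4 ∧ i = istar q m then m / 2 else 0 := by
    rw [if_congr hmem rfl rfl]
    by_cases h4 : q = 4
    · simp [h4, Finset.sum_ite_eq']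
    · simp [h4]
  rw [hsum, ← Finset.sum_add_distrib, ← smul_eq_mul]
  refine Finset.sum_eq_card_nsmul fun i _ => ?_
  have := Nat.two_mul_div_two_of_even hme
  unfold period
  split_ifs <;> omega

lemma union_eq_image {q m : ℕ} (hq : q = 2 ∨ q = 3 ∨ q = 4) (hm : 2 < m) (hme : Even m) (n : ℕ) :
    (⋃ i ∈ Finset.range n, coset q (q ^ (2 * m) - 1) (1 + (q + 1) * i)) =
      (fun p : (_ : ℕ) × ℕ => ((1 + (q + 1) * p.1 : ℕ) : ZMod (q ^ (2 * m) - 1)) *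
        (q : ZMod (q ^ (2 * m) - 1)) ^ (2 * p.2)) ''
        ((leaders q n).sigma fun i => Finset.range (period q m i) : Finset _) := by
  ext x
  simp only [Set.mem_iUnion, Set.mem_image, Finset.mem_coe, Finset.mem_sigma, Finset.mem_range]
  constructor
  · rintro ⟨i, hi, hx⟩
    obtain ⟨j, hj, l, rfl⟩ := exists_leader hq hi hx
    exact ⟨⟨j, l % period q m j⟩, ⟨hj, Nat.mod_lt _ (period_pos hm)⟩,
      mul_pow_mod_period (by omega) hme j l⟩
  · rintro ⟨⟨j, l⟩, ⟨hj, -⟩, rfl⟩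
    exact ⟨j, Finset.mem_range.1 (Finset.mem_filter.1 hj).1, l, rfl⟩

lemma injOn_shift {q m n : ℕ} (hq : q = 2 ∨ q = 3 ∨ q = 4) (hm : 2 < m) (hme : Even m)
    (hn : ∀ i < n, 1 + (q + 1) * i < q ^ (m + 1)) :
    Set.InjOn (fun p : (_ : ℕ) × ℕ => ((1 + (q + 1) * p.1 : ℕ) : ZMod (q ^ (2 * m) - 1)) *
        (q : ZMod (q ^ (2 * m) - 1)) ^ (2 * p.2))
      ((leaders q n).sigma fun i => Finset.range (period q m i) : Finset _) := by
  have hunit (k : ℕ) : IsUnit ((q : ZMod (q ^ (2 * m) - 1)) ^ k) := by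
    refine IsUnit.pow k (IsUnit.of_pow_eq_one (pow_two_mul_eq_one (m := m) ?_) ?_) <;> omega
  have hres (i : ℕ) : (1 + (q + 1) * i) % (q + 1) = 1 := by
    rw [Nat.add_mul_mod_self_left, Nat.mod_eq_of_lt (by omega)]
  have main {i j k l : ℕ} (hi : i ∈ leaders q n) (hj : j ∈ leaders q n)
      (hl : l < period q m j) (hkl : k ≤ l)
      (h : ((1 + (q + 1) * i : ℕ) : ZMod (q ^ (2 * m) - 1)) *
        (q : ZMod (q ^ (2 * m) - 1)) ^ (2 * k) = (1 + (q + 1) * j : ℕ) *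
        (q : ZMod (q ^ (2 * m) - 1)) ^ (2 * l)) : i = j ∧ k = l := by
    obtain ⟨d, rfl⟩ := Nat.exists_eq_add_of_le hkl
    simp only [leaders, Finset.mem_filter, Finset.mem_range] at hi hj
    have h' : ((1 + (q + 1) * i : ℕ) : ZMod (q ^ (2 * m) - 1)) = (1 + (q + 1) * j : ℕ) *
        (q : ZMod (q ^ (2 * m) - 1)) ^ (2 * d) := by
      refine (hunit (2 * k)).mul_right_cancel ?_
      rw [h, mul_assoc, ← pow_add]
      congr 2
      ring
    rcases Nat.eq_zero_or_pos d with rfl | hd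
    · rw [mul_zero, pow_zero, mul_one, ZMod.natCast_eq_natCast_iff] at h'
      have hM : q ^ (m + 1) < q ^ (2 * m) := Nat.pow_lt_pow_right (by omega) (by omega)
      have hi' := hn i hi.1
      have hj' := hn j hj.1
      have := h'.eq_of_lt_of_lt (by omega) (by omega)
      exact ⟨Nat.eq_of_mul_eq_mul_left (Nat.succ_pos q) (Nat.add_left_cancel this), rfl⟩
    · have hpm := period_le q m j
      obtain ⟨rfl, hj4, -, hdm⟩ := eq_of_shift hq hm hme (hn j hj.1) (hn i hi.1) (hres j) hj.2
        hi.2 hd (by omega) h'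
      have hjs : j = istar 4 m := by
        have := one_add_mul_istar hme
        omega
      rw [period, if_pos ⟨rfl, hjs⟩] at hl
      omega
  rintro ⟨i, k⟩ hik ⟨j, l⟩ hjl h
  simp only [Finset.mem_coe, Finset.mem_sigma, Finset.mem_range] at hik hjl
  rcases le_total k l with hkl | hkl
  · obtain ⟨rfl, rfl⟩ := main hik.1 hjl.1 hjl.2 hkl h
    rfl
  · obtain ⟨rfl, rfl⟩ := main hjl.1 hik.1 hik.2 hkl h.symm
    rfl

lemma lt_pow_of_le {q m δ i : ℕ} (hq : q = 2 ∨ q = 3 ∨ q = 4) (hm : 2 < m)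
    (hδmax : δ ≤ (q ^ (m + 1) - q ^ 2 + q + 3) / (q + 1)) (hi : i < δ - 1) :
    1 + (q + 1) * i < q ^ (m + 1) := by
  have hle : q ^ 2 ≤ q ^ (m + 1) := Nat.pow_le_pow_right (by omega) (by omega)
  rcases hq with rfl | rfl | rfl <;> norm_num at hle hδmax ⊢ <;> omega

lemma leaders_card_eq_N1 {q δ : ℕ} (hq : q = 2 ∨ q = 3 ∨ q = 4) (hδ : 2 ≤ δ) :
    ((leaders q (δ - 1)).card : ℤ) = (δ : ℤ) - N1 q δ - 1 := by
  rw [leaders_card hq, N1, Int.fdiv_eq_ediv_of_nonneg _ (by positivity)]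
  rcases hq with rfl | rfl | rfl <;> norm_num <;> omega

theorem stmt10 (q m : ℕ) (hq : q = 2 ∨ q = 3 ∨ q = 4) (hm : 2 < m) (hme : Even m)
    (r : ℕ) (hr : r = q + 1)
    (δ : ℕ) (hδ : 2 ≤ δ) (hδmax : δ ≤ (q ^ (m + 1) - q ^ 2 + q + 3) / (q + 1)) :
    ((⋃ i ∈ Finset.range (δ - 1), coset q (q ^ (2 * m) - 1) (1 + r * i)).ncard : ℤ)
      = if δ < istar q m + 2 then ((δ : ℤ) - N1 q δ - 1) * m
        else ((δ : ℤ) - N1 q δ - 1) * m - (m / 2 : ℕ) * (if q = 4 then 1 else 0) := by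
  subst hr
  rw [union_eq_image hq hm hme, Set.InjOn.ncard_image
    (injOn_shift hq hm hme fun i hi => lt_pow_of_le hq hm hδmax hi), Set.ncard_coe_finset,
    Finset.card_sigma, ← leaders_card_eq_N1 hq hδ]
  simp only [Finset.card_range]
  have h := sum_period (q := q) hm hme (δ - 1)
  have h' := congrArg (Nat.cast : ℕ → ℤ) h
  rw [Nat.cast_add, Nat.cast_mul] at h'
  rw [← h']
  by_cases h4 : q = 4
  · subst h4
    by_cases hd : istar 4 m < δ - 1
    · rw [if_neg (show ¬ δ < istar 4 m + 2 by omega), if_pos ⟨rfl, hd⟩]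
      simp
    · rw [if_pos (show δ < istar 4 m + 2 by omega), if_neg (by simpa using hd)]
      simp
  · simp [h4]
end
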